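/- arXiv:1511.09455 — 2 statements merged into one kernel-verified Lean document; each statement's English description precedes it below -/
import Mathlib

section
/- For every nonempty binary tree B, the following identity holds in ℤ[q_L, q_R]: ( Σ_{T ∈ NAT(B)} q_L^{inv(σ_L(T))} q_R^{inv(σ_R(T))} ) · ∏_{U ∈ LV(B)} [EL(U)]_{q_L} · ∏_{U ∈ RV(B)} [ER(U)]_{q_R} = [|LV(B)|]_{q_L}! · [|RV(B)|]_{q_R}!. -/
inductive BT : Type where
  | nil : BT
  | node : BT → BT → BT
  deriving DecidableEq

namespace BT

/-- The list of positions (paths from the root, `false` = left step, `true` = right step)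
of the vertices of a binary tree. -/
def paths : BT → List (List Bool)
  | .nil => []
  | .node l r => [] :: (l.paths.map (List.cons false) ++ r.paths.map (List.cons true))

/-- Number of vertices. -/
def size (B : BT) : ℕ := B.paths.length

/-- The set of left children (positions ending with a left step). -/
def leftVertices (B : BT) : Finset (List Bool) :=
  B.paths.toFinset.filter (fun p => p.getLast? = some false)

/-- The set of right children (positions ending with a right step). -/
def rightVertices (B : BT) : Finset (List Bool) :=
  B.paths.toFinset.filter (fun p => p.getLast? = some true)

end BT

/-- A non-ambiguous tree of shape `B`: bijective labellings of the left (resp. right)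
children by `Fin |LV B|` (resp. `Fin |RV B|`), decreasing along ancestry. -/
structure NAT (B : BT) where
  fL : {p // p ∈ B.leftVertices} → Fin B.leftVertices.card
  fR : {p // p ∈ B.rightVertices} → Fin B.rightVertices.card
  bijL : Function.Bijective fL
  bijR : Function.Bijective fR
  ancL : ∀ u v : {p // p ∈ B.leftVertices}, u.1 <+: v.1 → u ≠ v → (fL v : ℕ) < fL u
  ancR : ∀ u v : {p // p ∈ B.rightVertices}, u.1 <+: v.1 → u ≠ v → (fR v : ℕ) < fR u

namespace BT

/-- Positions of the left children of a binary tree in the left postfix reading order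
(the root of the tree being considered as *not* a left child): a tree `node L R` is read
by reading the left children of `L` (where `L`'s root *is* a left child, read last),
then those of `R`. -/
def readL : BT → List (List Bool)
  | .nil => []
  | .node l r =>
      (match l with
        | .nil => []
        | .node a b => readL (BT.node a b) ++ [([] : List Bool)]).map (List.cons false)
      ++ (readL r).map (List.cons true)

/-- Positions of the right children in the right postfix reading order (mirror of `readL`). -/
def readR : BT → List (List Bool)
  | .nil => []
  | .node l r =>
      (match r with
        | .nil => []
        | .node a b => readR (BT.node a b) ++ [([] : List Bool)]).map (List.cons true)
      ++ (readR l).map (List.cons false)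

end BT

/-- The one-line word (with values in `{1,…,|LV B|}`) of the permutation `σ_L(T)`
obtained by the left postfix reading of the left labels of `T`. -/
def wordL (B : BT) (T : NAT B) : List ℕ :=
  B.readL.map (fun p => if h : p ∈ B.leftVertices then (T.fL ⟨p, h⟩ : ℕ) + 1 else 0)

/-- The one-line word of the permutation `σ_R(T)`. -/
def wordR (B : BT) (T : NAT B) : List ℕ :=
  B.readR.map (fun p => if h : p ∈ B.rightVertices then (T.fR ⟨p, h⟩ : ℕ) + 1 else 0)

/-- The number of inversions of a word: pairs of positions `i < j` with `w_i > w_j`. -/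
def invWord (w : List ℕ) : ℕ :=
  ∑ j ∈ Finset.range w.length, ∑ i ∈ Finset.range j,
    if w.getD j 0 < w.getD i 0 then 1 else 0

/-- `EL B u`: the number of left children of `B` in the subtree rooted at `u`. -/
def EL (B : BT) (u : List Bool) : ℕ :=
  (B.leftVertices.filter (fun v => u <+: v)).card

/-- `ER B u`: the number of right children of `B` in the subtree rooted at `u`. -/
def ER (B : BT) (u : List Bool) : ℕ :=
  (B.rightVertices.filter (fun v => u <+: v)).card

/-- The `q`-integer `[n]_q = 1 + q + ⋯ + q^{n−1}`. -/
def qInt {R : Type*} [CommRing R] (q : R) (n : ℕ) : R := ∑ i ∈ Finset.range n, q ^ i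

/-- The `q`-factorial `[n]_q! = [1]_q [2]_q ⋯ [n]_q`. -/
def qFact {R : Type*} [CommRing R] (q : R) (n : ℕ) : R := ∏ i ∈ Finset.range n, qInt q (i + 1)

section Inversions

@[simp]
theorem invWord_nil : invWord [] = 0 := by simp [invWord]

theorem invWord_concat (w : List ℕ) (x : ℕ) :
    invWord (w ++ [x]) = invWord w + w.countP (fun a => x < a) := by
  have key : ∀ (v : List ℕ) (m : ℕ), m ≤ v.length →
      (∑ i ∈ Finset.range m, if x < v.getD i 0 then 1 else 0) =
        (v.take m).countP (fun a => x < a) := by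
    intro v m
    induction m with
    | zero => simp
    | succ m ih =>
      intro hm
      rw [Finset.sum_range_succ, ih (by omega), List.take_succ_eq_append_getElem (by omega),
        List.countP_append, List.getD_eq_getElem _ _ (by omega)]
      simp [List.countP_cons]
  unfold invWord
  rw [List.length_append, List.length_singleton, Finset.sum_range_succ]
  congr 1
  · refine Finset.sum_congr rfl fun j hj => Finset.sum_congr rfl fun i hi => ?_
    simp only [Finset.mem_range] at hi hj
    rw [List.getD_append _ _ _ _ hj, List.getD_append _ _ _ _ (hi.trans hj)]
  · have h := key w w.length le_rfl
    rw [List.take_length] at h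
    rw [← h]
    refine Finset.sum_congr rfl fun i hi => ?_
    simp only [Finset.mem_range] at hi
    rw [List.getD_append _ _ _ _ hi, List.getD_append_right _ _ _ _ le_rfl]
    simp

theorem invWord_append (v w : List ℕ) :
    invWord (v ++ w) =
      invWord v + invWord w + (w.map fun b => v.countP (fun a => b < a)).sum := by
  induction w using List.reverseRecOn with
  | nil => simp
  | append_singleton w x ih =>
    rw [← List.append_assoc, invWord_concat, ih, invWord_concat, List.countP_append]
    simp only [List.map_append, List.sum_append, List.map_cons, List.map_nil, List.sum_cons,
      List.sum_nil]
    omega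

end Inversions

section Words

/-- The words using every letter of the alphabet `S` exactly once. -/
def words (S : Finset ℕ) : Finset (List ℕ) := (Multiset.lists S.val).toFinset

theorem mem_words {S : Finset ℕ} {w : List ℕ} :
    w ∈ words S ↔ (w : Multiset ℕ) = S.val := by
  rw [words, Multiset.mem_toFinset, Multiset.mem_lists_iff]; exact eq_comm

theorem countP_eq_card_filter {S : Finset ℕ} {w : List ℕ} (hw : (w : Multiset ℕ) = S.val)
    (p : ℕ → Prop) [DecidablePred p] : w.countP (fun a => p a) = (S.filter p).card := by
  rw [Finset.card_def, Finset.filter_val, ← hw, ← Multiset.countP_eq_card_filter,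
    Multiset.coe_countP]

theorem sum_map_eq_sum {S : Finset ℕ} {w : List ℕ} (hw : (w : Multiset ℕ) = S.val)
    (f : ℕ → ℕ) : (w.map f).sum = ∑ b ∈ S, f b := by
  rw [Finset.sum, ← hw, Multiset.map_coe, Multiset.sum_coe]

/-- The number of pairs `(a, b) ∈ A × B` with `b < a`. -/
def crossInv (A B : Finset ℕ) : ℕ := ∑ b ∈ B, (A.filter fun a => b < a).card

theorem length_of_mem_words {S : Finset ℕ} {w : List ℕ} (hw : w ∈ words S) :
    w.length = S.card := by
  rw [mem_words] at hw
  rw [Finset.card_def, ← hw, Multiset.coe_card]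

theorem invWord_append_of_mem_words {A B : Finset ℕ} {v w : List ℕ}
    (hv : v ∈ words A) (hw : w ∈ words B) :
    invWord (v ++ w) = invWord v + invWord w + crossInv A B := by
  rw [mem_words] at hv hw
  rw [invWord_append, sum_map_eq_sum hw, crossInv]
  simp_rw [countP_eq_card_filter hv]

variable {R : Type*} [CommRing R]

/-- Splitting the words on the alphabet `S` after their first `n` letters. -/
theorem sum_words_split (S : Finset ℕ) (n : ℕ) (hn : n ≤ S.card) (F : List ℕ → R) :
    ∑ w ∈ words S, F w =
      ∑ A ∈ S.powersetCard n, ∑ v ∈ words A,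
        ∑ w ∈ words (S \ A), F (v ++ w) := by
  simp_rw [Finset.sum_sigma']
  symm
  refine Finset.sum_bij (fun x _ => x.2.1 ++ x.2.2) ?_ ?_ ?_ (fun _ _ => rfl)
  · rintro ⟨A, v, w⟩ h
    simp only [Finset.mem_sigma, Finset.mem_powersetCard, mem_words] at h ⊢
    obtain ⟨⟨hA, -⟩, hv, hw⟩ := h
    rw [← Multiset.coe_add, hv, hw, Finset.sdiff_val, add_comm]
    exact Multiset.sub_add_cancel (Finset.val_le_iff.2 hA)
  · rintro ⟨A, v, w⟩ h ⟨A', v', w'⟩ h' heq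
    simp only [Finset.mem_sigma, Finset.mem_powersetCard] at h h'
    obtain ⟨⟨hA, hc⟩, hv, hw⟩ := h
    obtain ⟨⟨hA', hc'⟩, hv', hw'⟩ := h'
    obtain ⟨rfl, rfl⟩ := List.append_inj heq (by
      rw [length_of_mem_words hv, length_of_mem_words hv', hc, hc'])
    rw [mem_words] at hv hv'
    obtain rfl : A = A' := Finset.val_injective (hv.symm.trans hv')
    rfl
  · intro w hw
    have hl := length_of_mem_words hw
    rw [mem_words] at hw
    have hnd : w.Nodup := by rw [← Multiset.coe_nodup, hw]; exact S.nodup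
    have ht : (w.take n).Nodup := hnd.sublist (List.take_sublist _ _)
    have hval : (w.take n).toFinset.val = (w.take n : Multiset ℕ) := by
      rw [List.toFinset_val, ht.dedup]
    have hadd : (w.take n : Multiset ℕ) + (w.drop n : Multiset ℕ) = S.val := by
      rw [Multiset.coe_add, List.take_append_drop, hw]
    refine ⟨⟨(w.take n).toFinset, w.take n, w.drop n⟩, ?_, List.take_append_drop _ _⟩
    simp only [Finset.mem_sigma, Finset.mem_powersetCard, mem_words]
    refine ⟨⟨?_, ?_⟩, hval.symm, ?_⟩
    · rw [← Finset.val_le_iff, hval, ← hadd]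
      exact Multiset.le_add_right _ _
    · rw [Finset.card_def, hval, Multiset.coe_card, List.length_take]
      omega
    · rw [Finset.sdiff_val, hval, ← hadd, add_tsub_cancel_left]

/-- Splitting off the last letter of the words on the alphabet `S`. -/
theorem sum_words_concat (S : Finset ℕ) (hS : S.Nonempty) (F : List ℕ → R) :
    ∑ w ∈ words S, F w =
      ∑ x ∈ S, ∑ w ∈ words (S.erase x), F (w ++ [x]) := by
  simp_rw [Finset.sum_sigma']
  symm
  refine Finset.sum_bij (fun x _ => x.2 ++ [x.1]) ?_ ?_ ?_ (fun _ _ => rfl)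
  · rintro ⟨x, w⟩ h
    simp only [Finset.mem_sigma, mem_words] at h ⊢
    obtain ⟨hx, hw⟩ := h
    rw [← Multiset.coe_add, hw, Finset.erase_val, add_comm, Multiset.coe_singleton,
      Multiset.singleton_add, Multiset.cons_erase hx]
  · rintro ⟨x, w⟩ h ⟨x', w'⟩ h' heq
    obtain ⟨rfl, h2⟩ := List.append_inj' heq rfl
    obtain rfl : x = x' := by simpa using h2
    rfl
  · intro w hw
    have hl := length_of_mem_words hw
    rw [mem_words] at hw
    have hne : w ≠ [] := by
      rintro rfl
      simp only [List.length_nil] at hl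
      have := hS.card_pos
      omega
    have hcat := List.dropLast_append_getLast hne
    refine ⟨⟨w.getLast hne, w.dropLast⟩, ?_, hcat⟩
    simp only [Finset.mem_sigma, mem_words]
    refine ⟨?_, ?_⟩
    · rw [← Finset.mem_val, ← hw]
      exact List.getLast_mem hne
    · conv_rhs => rw [Finset.erase_val, ← hw]
      conv_rhs => enter [1]; rw [← hcat]
      rw [← Multiset.coe_add, add_comm, Multiset.coe_singleton,
        Multiset.singleton_add, Multiset.erase_cons_head]

/-- The generating function, by inversions, of the words on the alphabet `S`
satisfying `P`. -/
noncomputable def wordGF (q : R) (P : List ℕ → Prop) (S : Finset ℕ) : R :=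
  open Classical in ∑ w ∈ words S, if P w then q ^ invWord w else 0

theorem wordGF_append (q : R) (P P₁ P₂ : List ℕ → Prop) (S : Finset ℕ) (n : ℕ)
    (hn : n ≤ S.card)
    (h : ∀ v w : List ℕ, v.length = n → w.length = S.card - n → (P (v ++ w) ↔ P₁ v ∧ P₂ w)) :
    wordGF q P S =
      ∑ A ∈ S.powersetCard n, q ^ crossInv A (S \ A) * (wordGF q P₁ A * wordGF q P₂ (S \ A)) := by
  classical
  unfold wordGF
  rw [sum_words_split S n hn]
  refine Finset.sum_congr rfl fun A hA => ?_
  rw [Finset.sum_mul_sum, Finset.mul_sum]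
  rw [Finset.mem_powersetCard] at hA
  refine Finset.sum_congr rfl fun v hv => ?_
  rw [Finset.mul_sum]
  refine Finset.sum_congr rfl fun w hw => ?_
  have hP := h v w (by rw [length_of_mem_words hv, hA.2])
    (by rw [length_of_mem_words hw, Finset.card_sdiff_of_subset hA.1, hA.2])
  rw [invWord_append_of_mem_words hv hw]
  by_cases h1 : P₁ v <;> by_cases h2 : P₂ w <;> simp [hP, h1, h2, pow_add]
  ring

theorem sum_pow_card_filter_lt (q : R) (S : Finset ℕ) :
    ∑ x ∈ S, q ^ (S.filter fun a => x < a).card = qInt q S.card := by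
  induction S using Finset.induction_on_min with
  | empty => simp [qInt]
  | insert a s ha ih =>
    have hna : a ∉ s := fun h => lt_irrefl _ (ha a h)
    rw [Finset.sum_insert hna, Finset.card_insert_of_notMem hna, qInt, Finset.sum_range_succ,
      ← qInt, ← ih, add_comm]
    congr 1
    · refine Finset.sum_congr rfl fun x hx => ?_
      rw [Finset.filter_insert, if_neg (ha x hx).not_gt]
    · rw [Finset.filter_insert, if_neg (lt_irrefl a), Finset.filter_true_of_mem ha]

theorem invWord_concat_of_mem_words {S : Finset ℕ} {x : ℕ} {w : List ℕ}
    (hw : w ∈ words (S.erase x)) :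
    invWord (w ++ [x]) = invWord w + (S.filter fun a => x < a).card := by
  rw [invWord_concat, countP_eq_card_filter (mem_words.1 hw), Finset.filter_erase,
    Finset.erase_eq_of_notMem (by simp)]

/-- The inversion generating function of all words is the `q`-factorial. -/
theorem wordGF_true (q : R) (S : Finset ℕ) : wordGF q (fun _ => True) S = qFact q S.card := by
  induction hn : S.card generalizing S with
  | zero =>
    obtain rfl := Finset.card_eq_zero.1 hn
    have : words ∅ = {[]} := by
      ext w
      rw [mem_words]
      simp
    simp [wordGF, qFact, this]
  | succ n ih =>
    have hS : S.Nonempty := Finset.card_pos.1 (by omega)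
    rw [wordGF, sum_words_concat S hS, qFact, Finset.prod_range_succ, ← qFact, ← hn,
      ← sum_pow_card_filter_lt, Finset.mul_sum]
    refine Finset.sum_congr rfl fun x hx => ?_
    rw [← ih (S.erase x) (by rw [Finset.card_erase_of_mem hx]; omega), wordGF, Finset.sum_mul]
    refine Finset.sum_congr rfl fun w hw => ?_
    rw [invWord_concat_of_mem_words hw]
    simp [pow_add]

/-- Appending a last letter which has to be the largest one. -/
theorem wordGF_concat_max (q : R) (P P₁ : List ℕ → Prop) (S : Finset ℕ) (hS : S.Nonempty)
    (h : ∀ (w : List ℕ) (x : ℕ), w.length + 1 = S.card →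
      (P (w ++ [x]) ↔ P₁ w ∧ ∀ a ∈ w, a < x)) :
    wordGF q P S = wordGF q P₁ (S.erase (S.max' hS)) := by
  classical
  unfold wordGF
  rw [sum_words_concat S hS, Finset.sum_eq_single_of_mem _ (S.max'_mem hS)]
  · refine Finset.sum_congr rfl fun w hw => ?_
    have hlen : w.length + 1 = S.card := by
      rw [length_of_mem_words hw, Finset.card_erase_add_one (S.max'_mem hS)]
    rw [invWord_concat_of_mem_words hw, Finset.filter_false_of_mem
      (fun a ha => (S.le_max' a ha).not_gt), Finset.card_empty, add_zero]
    refine if_congr ((h w _ hlen).trans (and_iff_left fun a ha => ?_)) rfl rfl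
    have ha' : a ∈ S.erase (S.max' hS) := by
      rw [← Finset.mem_val, ← mem_words.1 hw]; exact ha
    exact S.lt_max'_of_mem_erase_max' hS ha'
  · intro x hx hne
    refine Finset.sum_eq_zero fun w hw => if_neg fun hP => ?_
    have hlen : w.length + 1 = S.card := by
      rw [length_of_mem_words hw, Finset.card_erase_add_one hx]
    have hm : S.max' hS ∈ w := by
      rw [← Multiset.mem_coe, mem_words.1 hw, Finset.mem_val]
      exact Finset.mem_erase.2 ⟨hne.symm, S.max'_mem hS⟩
    exact (S.le_max' x hx).not_gt (((h w x hlen).1 hP).2 _ hm)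

end Words

section Forests

/-- The words `w` whose letters, placed at the positions listed by `r`, decrease along
ancestry. -/
def IsDecreasingAlong (r : List (List Bool)) (w : List ℕ) : Prop :=
  (r.zip w).Pairwise fun x y => (x.1 <+: y.1 → y.2 < x.2) ∧ (y.1 <+: x.1 → x.2 < y.2)

/-- Lists of positions obtained as postfix readings of forests. -/
inductive IsPostfixReading : List (List Bool) → Prop
  | nil : IsPostfixReading []
  | root (r : List (List Bool)) : IsPostfixReading r → [] ∉ r → IsPostfixReading (r ++ [[]])
  | append (c d : Bool) (r s : List (List Bool)) : c ≠ d → IsPostfixReading r →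
      IsPostfixReading s → IsPostfixReading (r.map (List.cons c) ++ s.map (List.cons d))

theorem isDecreasingAlong_map_cons (c : Bool) (r : List (List Bool)) (w : List ℕ) :
    IsDecreasingAlong (r.map (List.cons c)) w ↔ IsDecreasingAlong r w := by
  simp [IsDecreasingAlong, List.zip_map_left, List.pairwise_map, List.cons_prefix_cons]

theorem isDecreasingAlong_append {c d : Bool} (hcd : c ≠ d) (r s : List (List Bool))
    (v w : List ℕ) (hv : v.length = r.length) :
    IsDecreasingAlong (r.map (List.cons c) ++ s.map (List.cons d)) (v ++ w) ↔
      IsDecreasingAlong r v ∧ IsDecreasingAlong s w := by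
  rw [← isDecreasingAlong_map_cons c r, ← isDecreasingAlong_map_cons d s]
  unfold IsDecreasingAlong
  rw [List.zip_append (by simp [hv]), List.pairwise_append, ← and_assoc, and_iff_left]
  rintro ⟨p, a⟩ hp ⟨p', b⟩ hp'
  obtain ⟨p, -, rfl⟩ := List.mem_map.1 (List.of_mem_zip hp).1
  obtain ⟨p', -, rfl⟩ := List.mem_map.1 (List.of_mem_zip hp').1
  simp [List.cons_prefix_cons, hcd, hcd.symm]

theorem isDecreasingAlong_root (r : List (List Bool)) (hr : [] ∉ r) (w : List ℕ) (x : ℕ)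
    (hw : w.length = r.length) :
    IsDecreasingAlong (r ++ [[]]) (w ++ [x]) ↔ IsDecreasingAlong r w ∧ ∀ a ∈ w, a < x := by
  unfold IsDecreasingAlong
  rw [List.zip_append hw.symm, List.pairwise_append]
  simp only [List.zip_cons_cons, List.zip_nil_left, List.pairwise_singleton, true_and,
    List.mem_singleton, forall_eq, List.prefix_nil, List.nil_prefix, forall_const]
  refine and_congr_right fun _ => ⟨fun h a ha => ?_, ?_⟩
  · rw [← List.map_snd_zip (l₁ := r) hw.le, List.mem_map] at ha
    obtain ⟨y, hy, rfl⟩ := ha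
    exact (h y hy).2
  · rintro h ⟨p, a⟩ hp
    have := List.of_mem_zip hp
    exact ⟨fun h0 => absurd (h0 ▸ this.1) hr, h a this.2⟩

theorem IsPostfixReading.nodup {r : List (List Bool)} (hr : IsPostfixReading r) : r.Nodup := by
  induction hr with
  | nil => exact List.nodup_nil
  | root r _ h0 ih => exact ih.append (List.nodup_singleton _) (by simpa using h0)
  | append c d r s hcd _ _ ihr ihs =>
    refine (ihr.map (List.cons_injective)).append (ihs.map (List.cons_injective)) ?_
    intro p hp hp'
    obtain ⟨p, -, rfl⟩ := List.mem_map.1 hp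
    obtain ⟨p', -, h⟩ := List.mem_map.1 hp'
    exact hcd (List.cons.inj h).1.symm

variable {R : Type*} [CommRing R]

/-- The product of the `q`-integers of the hook lengths of a forest. -/
def hookProd (q : R) (r : List (List Bool)) : R :=
  (r.map fun u => qInt q (r.countP fun v => u <+: v)).prod

theorem hookProd_append (q : R) {c d : Bool} (hcd : c ≠ d) (r s : List (List Bool)) :
    hookProd q (r.map (List.cons c) ++ s.map (List.cons d)) = hookProd q r * hookProd q s := by
  simp [hookProd, List.countP_append, List.countP_map, Function.comp_def,
    List.cons_prefix_cons, hcd, hcd.symm]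

theorem hookProd_root (q : R) (r : List (List Bool)) (hr : [] ∉ r) :
    hookProd q (r ++ [[]]) = hookProd q r * qInt q (r.length + 1) := by
  unfold hookProd
  rw [List.map_append, List.prod_append]
  congr 1
  · congr 1
    refine List.map_congr_left fun u hu => ?_
    have : u ≠ [] := fun h => hr (h ▸ hu)
    simp [List.countP_append, this]
  · simp [List.countP_append]

/-- The `q`-hook length formula for forests. -/
theorem IsPostfixReading.wordGF_mul_hookProd (q : R) {r : List (List Bool)}
    (hr : IsPostfixReading r) (S : Finset ℕ) (hS : S.card = r.length) :
    wordGF q (IsDecreasingAlong r) S * hookProd q r = qFact q S.card := by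
  induction hr generalizing S with
  | nil =>
    rw [← wordGF_true]
    simp [hookProd, IsDecreasingAlong, wordGF]
  | root r hr h0 ih =>
    rw [List.length_append, List.length_singleton] at hS
    have hne : S.Nonempty := Finset.card_pos.1 (by omega)
    have hc : (S.erase (S.max' hne)).card = r.length := by
      rw [Finset.card_erase_of_mem (S.max'_mem hne)]; omega
    rw [hookProd_root q r h0, wordGF_concat_max q _ (IsDecreasingAlong r) S hne
      fun w x hw => isDecreasingAlong_root r h0 w x (by omega), ← mul_assoc, ih _ hc, hc, hS,
      qFact, qFact, Finset.prod_range_succ]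
  | append c d r s hcd hr hs ihr ihs =>
    simp only [List.length_append, List.length_map] at hS
    rw [hookProd_append q hcd, ← wordGF_true,
      wordGF_append q _ (IsDecreasingAlong r) (IsDecreasingAlong s) S r.length (by omega)
        fun v w hv _ => isDecreasingAlong_append hcd r s v w hv,
      wordGF_append q (fun _ => True) (fun _ => True) (fun _ => True) S r.length (by omega)
        (by simp), Finset.sum_mul]
    refine Finset.sum_congr rfl fun A hA => ?_
    rw [Finset.mem_powersetCard] at hA
    rw [wordGF_true, wordGF_true, ← ihr A hA.2,
      ← ihs (S \ A) (by rw [Finset.card_sdiff_of_subset hA.1]; omega)]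
    ring

end Forests

section Labellings

/-- The bijective labellings of a set of positions that decrease along ancestry. -/
abbrev DecreasingLabelling (V : Finset (List Bool)) : Type :=
  {f : {p // p ∈ V} → Fin V.card // Function.Bijective f ∧
    ∀ u v : {p // p ∈ V}, u.1 <+: v.1 → u ≠ v → (f v : ℕ) < f u}

/-- The word obtained by reading the labels, shifted by one, along a list of positions. -/
def labelWord {V : Finset (List Bool)} (r : List (List Bool)) (f : {p // p ∈ V} → Fin V.card) :
    List ℕ :=
  r.map fun p => if h : p ∈ V then (f ⟨p, h⟩ : ℕ) + 1 else 0

/-- The non-ambiguous trees are pairs of decreasing labellings. -/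
def natEquiv (B : BT) :
    NAT B ≃ DecreasingLabelling B.leftVertices × DecreasingLabelling B.rightVertices where
  toFun T := (⟨T.fL, T.bijL, T.ancL⟩, ⟨T.fR, T.bijR, T.ancR⟩)
  invFun x := ⟨x.1.1, x.2.1, x.1.2.1, x.2.2.1, x.1.2.2, x.2.2.2⟩
  left_inv _ := rfl
  right_inv _ := rfl

variable {V : Finset (List Bool)} {r : List (List Bool)}

theorem isDecreasingAlong_labelWord (hnd : r.Nodup) (hV : ∀ p, p ∈ r ↔ p ∈ V)
    (f : {p // p ∈ V} → Fin V.card) :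
    IsDecreasingAlong r (labelWord r f) ↔
      ∀ u v : {p // p ∈ V}, u.1 <+: v.1 → u ≠ v → (f v : ℕ) < f u := by
  set g : List Bool → ℕ := fun p => if h : p ∈ V then (f ⟨p, h⟩ : ℕ) + 1 else 0 with hg
  have hgv : ∀ u : {p // p ∈ V}, g u.1 = f u + 1 := fun u => by simp [hg, u.2]
  have hz : r.zip (r.map g) = r.map fun p => (p, g p) := by
    simpa using List.zip_map' (f := (id : List Bool → List Bool)) (g := g) (l := r)
  change (r.zip (r.map g)).Pairwise _ ↔ _
  rw [hz, List.pairwise_map]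
  constructor
  · intro h u v huv hne
    have : Std.Symm fun a b : List Bool =>
        (a <+: b → g b < g a) ∧ (b <+: a → g a < g b) := ⟨fun _ _ hab => ⟨hab.2, hab.1⟩⟩
    have := List.Pairwise.forall h ((hV _).2 u.2) ((hV _).2 v.2)
      (fun h => hne (Subtype.ext h))
    have h3 := this.1 huv
    simp only [hgv] at h3
    omega
  · intro h
    refine hnd.pairwise_of_forall_ne fun a ha b hb hab => ?_
    have h1 := h ⟨a, (hV a).1 ha⟩ ⟨b, (hV b).1 hb⟩
    have h2 := h ⟨b, (hV b).1 hb⟩ ⟨a, (hV a).1 ha⟩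
    have ga := hgv ⟨a, (hV a).1 ha⟩
    have gb := hgv ⟨b, (hV b).1 hb⟩
    simp only at ga gb
    refine ⟨fun hp => ?_, fun hp => ?_⟩
    · have := h1 hp (by simpa using hab)
      omega
    · have := h2 hp (by simpa using hab.symm)
      omega

theorem length_eq_card (hnd : r.Nodup) (hV : ∀ p, p ∈ r ↔ p ∈ V) : r.length = V.card := by
  rw [← List.toFinset_card_of_nodup hnd]
  congr 1
  ext; simp [hV]

theorem labelWord_mem_words (hnd : r.Nodup) (hV : ∀ p, p ∈ r ↔ p ∈ V)
    {f : {p // p ∈ V} → Fin V.card} (hf : Function.Injective f) :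
    labelWord r f ∈ words (Finset.Icc 1 V.card) := by
  have hw : (labelWord r f).Nodup := by
    refine hnd.map_on fun p hp p' hp' h => ?_
    simp only [(hV _).1 hp, (hV _).1 hp', dite_true, add_left_inj] at h
    exact congrArg Subtype.val (hf (Fin.ext h))
  have hval : (labelWord r f).toFinset.val = (labelWord r f : Multiset ℕ) := by
    rw [List.toFinset_val, hw.dedup]
  rw [mem_words, ← hval]
  congr 1
  refine Finset.eq_of_subset_of_card_le (fun a ha => ?_) ?_
  · simp only [labelWord, List.mem_toFinset, List.mem_map] at ha
    obtain ⟨p, hp, rfl⟩ := ha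
    have := (f ⟨p, (hV p).1 hp⟩).2
    simp only [(hV _).1 hp, dite_true, Finset.mem_Icc]
    omega
  · rw [List.toFinset_card_of_nodup hw, labelWord, List.length_map, length_eq_card hnd hV]
    simp

theorem labelWord_injective (hV : ∀ p, p ∈ r ↔ p ∈ V) :
    Function.Injective (labelWord r : ({p // p ∈ V} → Fin V.card) → List ℕ) := by
  intro f g h
  ext ⟨p, hp⟩
  have := List.map_inj_left.1 h p ((hV p).2 hp)
  simpa [hp] using this

theorem exists_labelWord_eq (hnd : r.Nodup) (hV : ∀ p, p ∈ r ↔ p ∈ V) {w : List ℕ}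
    (hw : w ∈ words (Finset.Icc 1 V.card)) :
    ∃ f : {p // p ∈ V} → Fin V.card, Function.Bijective f ∧ labelWord r f = w := by
  have hlen := length_of_mem_words hw
  rw [Nat.card_Icc, Nat.add_sub_cancel, ← length_eq_card hnd hV] at hlen
  rw [mem_words] at hw
  have hwnd : w.Nodup := by rw [← Multiset.coe_nodup, hw]; exact Finset.nodup _
  have hmem : ∀ a ∈ w, 1 ≤ a ∧ a ≤ V.card := fun a ha => by
    rwa [← Multiset.mem_coe, hw, Finset.mem_val, Finset.mem_Icc] at ha
  have hidx : ∀ p : {p // p ∈ V}, r.idxOf p.1 < w.length := fun p => by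
    rw [hlen]; exact List.idxOf_lt_length_of_mem ((hV _).2 p.2)
  have hbd : ∀ p, 1 ≤ w[r.idxOf p.1]'(hidx p) ∧ w[r.idxOf p.1]'(hidx p) ≤ V.card :=
    fun p => hmem _ (List.getElem_mem _)
  let f : {p // p ∈ V} → Fin V.card := fun p =>
    ⟨w[r.idxOf p.1]'(hidx p) - 1, by have := hbd p; omega⟩
  refine ⟨f, (Fintype.bijective_iff_injective_and_card f).2 ⟨fun p p' h => ?_, by simp⟩, ?_⟩
  · have h1 := hbd p
    have h2 := hbd p'
    have h3 : w[r.idxOf p.1]'(hidx p) - 1 = w[r.idxOf p'.1]'(hidx p') - 1 := congrArg Fin.val h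
    have h4 : w[r.idxOf p.1]'(hidx p) = w[r.idxOf p'.1]'(hidx p') := by omega
    exact Subtype.ext ((List.idxOf_inj ((hV _).2 p.2)).1 (hwnd.getElem_inj_iff.1 h4))
  · refine List.ext_getElem (by simp [labelWord, hlen]) fun i h1 h2 => ?_
    have hi : i < r.length := by rwa [← hlen]
    have hm : r[i] ∈ V := (hV _).1 (List.getElem_mem hi)
    have h3 := hmem _ (List.getElem_mem h2)
    simp only [labelWord, List.getElem_map, hm, dite_true, f, hnd.idxOf_getElem]
    omega

theorem sum_decreasingLabelling {R : Type*} [CommRing R] (q : R) (hnd : r.Nodup)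
    (hV : ∀ p, p ∈ r ↔ p ∈ V) :
    ∑ f : DecreasingLabelling V, q ^ invWord (labelWord r f.1) =
      wordGF q (IsDecreasingAlong r) (Finset.Icc 1 V.card) := by
  classical
  rw [wordGF, ← Finset.sum_filter]
  refine Finset.sum_bij (fun f _ => labelWord r f.1) (fun f _ => ?_) (fun f _ g _ h => ?_)
    (fun w hw => ?_) (fun _ _ => rfl)
  · exact Finset.mem_filter.2 ⟨labelWord_mem_words hnd hV f.2.1.1,
      (isDecreasingAlong_labelWord hnd hV f.1).2 f.2.2⟩
  · exact Subtype.ext (labelWord_injective hV h)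
  · obtain ⟨hw, hdec⟩ := Finset.mem_filter.1 hw
    obtain ⟨f, hf, rfl⟩ := exists_labelWord_eq hnd hV hw
    exact ⟨⟨f, hf, (isDecreasingAlong_labelWord hnd hV f).1 hdec⟩, Finset.mem_univ _, rfl⟩

theorem hookProd_eq_prod {R : Type*} [CommRing R] (q : R) (hnd : r.Nodup)
    (hV : ∀ p, p ∈ r ↔ p ∈ V) :
    hookProd q r = ∏ u ∈ V, qInt q (V.filter fun v => u <+: v).card := by
  obtain rfl : r.toFinset = V := by ext; simp [hV]
  rw [hookProd, List.prod_toFinset _ hnd]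
  congr 1
  refine List.map_congr_left fun u _ => ?_
  rw [List.countP_eq_length_filter, ← List.toFinset_card_of_nodup (hnd.filter _),
    List.toFinset_filter]
  simp

/-- The `q`-hook length formula for decreasing labellings. -/
theorem IsPostfixReading.sum_labelling_mul_prod {R : Type*} [CommRing R] (q : R)
    (hr : IsPostfixReading r) (hV : ∀ p, p ∈ r ↔ p ∈ V) :
    (∑ f : DecreasingLabelling V, q ^ invWord (labelWord r f.1)) *
      ∏ u ∈ V, qInt q (V.filter fun v => u <+: v).card = qFact q V.card := by
  rw [sum_decreasingLabelling q hr.nodup hV, ← hookProd_eq_prod q hr.nodup hV,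
    hr.wordGF_mul_hookProd q _ (by simp [length_eq_card hr.nodup hV])]
  simp

end Labellings

namespace BT

theorem readL_node (l r : BT) : readL (node l r) =
    (if l = nil then [] else readL l ++ [[]]).map (List.cons false) ++
      (readL r).map (List.cons true) := by
  cases l <;> simp [readL]

theorem readR_node (l r : BT) : readR (node l r) =
    (if r = nil then [] else readR r ++ [[]]).map (List.cons true) ++
      (readR l).map (List.cons false) := by
  cases r <;> simp [readR]

theorem nil_mem_paths (B : BT) : [] ∈ B.paths ↔ B ≠ nil := by
  cases B <;> simp [paths]

theorem mem_readL (B : BT) (p : List Bool) : p ∈ B.readL ↔ p ∈ B.leftVertices := by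
  simp only [leftVertices, Finset.mem_filter, List.mem_toFinset]
  induction B generalizing p with
  | nil => simp [readL, paths]
  | node l r ihl ihr =>
    rw [readL_node, paths]
    rcases p with _ | ⟨_ | _, p⟩
    · simp
    · rcases eq_or_ne p [] with rfl | hp
      · by_cases hl : l = nil <;> simp [hl, nil_mem_paths, paths]
      · by_cases hl : l = nil <;>
          simp [hl, hp, ihl, paths, List.getLast?_cons_of_ne_nil]
    · rcases eq_or_ne p [] with rfl | hp
      · simp [ihr]
      · simp [hp, ihr, List.getLast?_cons_of_ne_nil]

theorem mem_readR (B : BT) (p : List Bool) : p ∈ B.readR ↔ p ∈ B.rightVertices := by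
  simp only [rightVertices, Finset.mem_filter, List.mem_toFinset]
  induction B generalizing p with
  | nil => simp [readR, paths]
  | node l r ihl ihr =>
    rw [readR_node, paths]
    rcases p with _ | ⟨_ | _, p⟩
    · simp
    · rcases eq_or_ne p [] with rfl | hp
      · simp [ihl]
      · simp [hp, ihl, List.getLast?_cons_of_ne_nil]
    · rcases eq_or_ne p [] with rfl | hp
      · by_cases hr : r = nil <;> simp [hr, nil_mem_paths, paths]
      · by_cases hr : r = nil <;>
          simp [hr, hp, ihr, paths, List.getLast?_cons_of_ne_nil]

theorem isPostfixReading_readL (B : BT) : IsPostfixReading B.readL := by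
  induction B with
  | nil => exact .nil
  | node l r ihl ihr =>
    rw [readL_node]
    refine .append _ _ _ _ (by decide) ?_ ihr
    split_ifs
    · exact .nil
    · exact .root _ ihl (by simp [mem_readL, leftVertices])

theorem isPostfixReading_readR (B : BT) : IsPostfixReading B.readR := by
  induction B with
  | nil => exact .nil
  | node l r ihl ihr =>
    rw [readR_node]
    refine .append _ _ _ _ (by decide) ?_ ihl
    split_ifs
    · exact .nil
    · exact .root _ ihr (by simp [mem_readR, rightVertices])

end BT

open MvPolynomial in
/-- `q`-hook formula, inversion statistic. In `ℤ[q_L,q_R]`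
(with `q_L = X 0`, `q_R = X 1`):
`(Σ_{T ∈ NAT(B)} q_L^{inv σ_L(T)} q_R^{inv σ_R(T)}) · ∏_U [EL U]_{q_L} · ∏_U [ER U]_{q_R}
  = [|LV B|]_{q_L}! · [|RV B|]_{q_R}!`. -/
theorem nat_q_hook_inv (B : BT) (hB : B ≠ BT.nil) :
    (∑ᶠ T : NAT B,
        (X 0 : MvPolynomial (Fin 2) ℤ) ^ invWord (wordL B T) * (X 1) ^ invWord (wordR B T)) *
        (∏ u ∈ B.leftVertices, qInt (X 0 : MvPolynomial (Fin 2) ℤ) (EL B u)) *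
        (∏ u ∈ B.rightVertices, qInt (X 1 : MvPolynomial (Fin 2) ℤ) (ER B u)) =
      qFact (X 0 : MvPolynomial (Fin 2) ℤ) B.leftVertices.card *
        qFact (X 1 : MvPolynomial (Fin 2) ℤ) B.rightVertices.card := by
  classical
  have hsum : (∑ᶠ T : NAT B,
      (X 0 : MvPolynomial (Fin 2) ℤ) ^ invWord (wordL B T) * (X 1) ^ invWord (wordR B T)) =
      (∑ f : DecreasingLabelling B.leftVertices, X 0 ^ invWord (labelWord B.readL f.1)) *
        ∑ g : DecreasingLabelling B.rightVertices, X 1 ^ invWord (labelWord B.readR g.1) := by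
    rw [← finsum_comp_equiv (natEquiv B).symm, finsum_eq_sum_of_fintype, Finset.sum_mul_sum,
      ← Finset.sum_product', Finset.univ_product_univ]
    rfl
  rw [hsum, ← B.isPostfixReading_readL.sum_labelling_mul_prod _ B.mem_readL,
    ← B.isPostfixReading_readR.sum_labelling_mul_prod _ B.mem_readR]
  simp only [EL, ER]
  ring
end

section
/- Fix integers d ≥ k ≥ 1. Let G := Σ_N ∏_{i=1}^d x_i^{w_i(N)−1}/(w_i(N)−1)! in ℚ[[x_1,…,x_d]], the sum running over all (d,k)-NATs N (over all shapes), where (w_1(N),…,w_d(N)) is the root label of N. Then G = ∏_{π a (d,k)-direction} (1 + ∫_π G), where for π = {i_1,…,i_k}, ∫_π denotes the composition of the formal integration operators ∫_{x_{i_1}}, …, ∫_{x_{i_k}} (and ∫_{x_i} maps a monomial x_i^m·m' to x_i^{m+1}·m'/(m+1)). -/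
/-- A `(d,k)`-direction: a `k`-element subset of the `d` coordinates. -/
abbrev Dir (d k : ℕ) := {π : Finset (Fin d) // π.card = k}

/-- A `(d,k)`-ary tree: every vertex has at most one child for each `(d,k)`-direction. -/
inductive KTree (d k : ℕ) : Type where
  | node : (Dir d k → Option (KTree d k)) → KTree d k

namespace KTree

variable {d k : ℕ}

/-- The subtree of a `(d,k)`-ary tree at a given position (path of directions),
if the position exists in the tree. -/
def subtreeAt : KTree d k → List (Dir d k) → Option (KTree d k)
  | t, [] => some t
  | .node c, π :: p =>
    match c π with
    | some t => subtreeAt t p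
    | none => none

/-- `p` is (the position of) a vertex of `M`. -/
def isVertex (M : KTree d k) (p : List (Dir d k)) : Prop := (M.subtreeAt p).isSome

end KTree

/-- The direction of the vertex at position `p`: the direction indexing it as a child of its
parent; the root (empty position) has direction `{1,…,d}`. -/
def dirOf {d k : ℕ} (p : List (Dir d k)) : Finset (Fin d) :=
  (p.getLast?).elim Finset.univ Subtype.val

/-- A non-ambiguous tree of dimension `(d,k)` of shape `M`: each vertex of direction `π`
carries a tuple of positive integers indexed by `π` (the root carrying a full `d`-tuple),
encoded as a function `lbl` which vanishes at the unused positions; entries strictly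
decrease from ancestors to descendants, and for each coordinate `i` the `i`-th entries are
pairwise distinct and form an integer interval with minimum `1`. -/
structure KNAT (d k : ℕ) (M : KTree d k) where
  lbl : List (Dir d k) → Fin d → ℕ
  supp : ∀ p i, ¬(M.isVertex p ∧ i ∈ dirOf p) → lbl p i = 0
  anc : ∀ p q, M.isVertex p → M.isVertex q → p <+: q → p ≠ q →
    ∀ i, i ∈ dirOf p → i ∈ dirOf q → lbl q i < lbl p i
  inj : ∀ i : Fin d, Set.InjOn (fun p => lbl p i) {p | M.isVertex p ∧ i ∈ dirOf p}
  interval : ∀ i : Fin d,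
    (fun p => lbl p i) '' {p | M.isVertex p ∧ i ∈ dirOf p} =
      Set.Icc 1 (Set.ncard {p | M.isVertex p ∧ i ∈ dirOf p})

/-- The exponential generating series of `(d,k)`-NATs:
`G = Σ_N ∏_i x_i^{w_i(N)−1}/(w_i(N)−1)!`, encoded by its coefficients. -/
noncomputable def knatGF (d k : ℕ) : MvPowerSeries (Fin d) ℚ :=
  fun e =>
    (Nat.card {N : Σ M : KTree d k, KNAT d k M // ∀ i, N.2.lbl [] i = e i + 1} : ℚ) /
      ∏ i : Fin d, ((e i).factorial : ℚ)

/-- Formal integration of a power series once in each of the variables of `s`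
(the composition `∫_{x_{i₁}} ⋯ ∫_{x_{i_k}}` for `s = {i₁,…,i_k}`). -/
noncomputable def intS {d : ℕ} (s : Finset (Fin d)) (f : MvPowerSeries (Fin d) ℚ) :
    MvPowerSeries (Fin d) ℚ :=
  fun e =>
    if ∀ i ∈ s, e i ≠ 0 then
      (∏ i ∈ s, (e i : ℚ))⁻¹ * f (e - ∑ i ∈ s, Finsupp.single i 1)
    else 0

/-- The order-reversing bijections from `S`, equipped with the relation `r`, to `T`. -/
abbrev AntiBij {S : Type*} (r : S → S → Prop) (T : Type*) [LT T] :=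
  {f : S ≃ T // ∀ a b, r a b → f b < f a}

namespace AntiBij

/-- Transport along a relation isomorphism of sources and an order isomorphism of targets. -/
def congr {S S' T T' : Type*} [Preorder T] [Preorder T'] {r : S → S → Prop}
    {r' : S' → S' → Prop} (e : S ≃ S') (o : T ≃o T') (h : ∀ a b, r a b ↔ r' (e a) (e b)) :
    AntiBij r T ≃ AntiBij r' T' :=
  Equiv.subtypeEquiv (Equiv.equivCongr e o.toEquiv) fun f => by
    refine ⟨fun H a b hab => ?_, fun H a b hab => ?_⟩
    · simpa using H (e.symm a) (e.symm b) ((h _ _).2 (by simpa using hab))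
    · simpa using H (e a) (e b) ((h _ _).1 hab)

instance {S T : Type*} [Finite T] (r : S → S → Prop) [LT T] : Finite (AntiBij r T) := by
  unfold AntiBij
  rcases isEmpty_or_nonempty (S ≃ T) with h | ⟨⟨e⟩⟩
  · infer_instance
  · have := Finite.of_equiv T e.symm
    infer_instance

/-- The number of order-reversing bijections to a finite linear order only depends on the size
of the target. -/
theorem card_eq_ite {S T : Type*} [LinearOrder T] [Finite S] [Finite T] (r : S → S → Prop) :
    Nat.card (AntiBij r T) =
      if Nat.card T = Nat.card S then Nat.card (AntiBij r (Fin (Nat.card S))) else 0 := by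
  split_ifs with h
  · have := Fintype.ofFinite T
    refine Nat.card_congr (congr (Equiv.refl _) ?_ (fun _ _ => Iff.rfl))
    exact (Fintype.orderIsoFinOfCardEq T (by rw [← Nat.card_eq_fintype_card, h])).symm
  · have : IsEmpty (AntiBij r T) := ⟨fun f => h (Nat.card_congr f.1).symm⟩
    exact Nat.card_of_isEmpty

/-- Order-reversing bijections from a disjoint union inducing a given partition of the target. -/
noncomputable def fiberEquiv {J T : Type*} {S : J → Type*} [LT T]
    (r : ∀ j, S j → S j → Prop) (χ : T → J) :
    {f : AntiBij (Sigma.Lex (fun _ _ => False) r) T // (fun t => (f.1.symm t).1) = χ} ≃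
      ∀ j, AntiBij (r j) {t // χ t = j} where
  toFun f j := ⟨Equiv.ofBijective
    (fun s => ⟨f.1.1 ⟨j, s⟩, (congrFun f.2 _).symm.trans (by simp)⟩) ⟨fun a b h => by
      simpa using h, fun ⟨t, ht⟩ => by
      obtain ⟨⟨i, s⟩, rfl⟩ := f.1.1.surjective t
      have hi : i = j := by simpa using (congrFun f.2 _).trans ht
      subst hi
      exact ⟨s, rfl⟩⟩, fun a b hab => f.1.2 _ _ (Sigma.Lex.right _ _ hab)⟩
  invFun g :=
    ⟨⟨(Equiv.sigmaCongrRight fun j => (g j).1).trans (Equiv.sigmaFiberEquiv χ), by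
      rintro _ _ (⟨_, _, h⟩ | ⟨a, b, h⟩)
      · exact h.elim
      · exact (g _).2 _ _ h⟩, rfl⟩
  left_inv f := by
    apply Subtype.ext; apply Subtype.ext; ext ⟨j, s⟩; rfl
  right_inv g := by
    funext j; apply Subtype.ext; ext s; rfl

open Classical in
/-- Order-reversing bijections from a disjoint union are counted by the admissible partitions of
the target times the product of the counts for the components. -/
theorem card_sigma_eq {J : Type*} [Fintype J] {S : J → Type*} [∀ j, Finite (S j)]
    (r : ∀ j, S j → S j → Prop) (n : ℕ) :
    Nat.card (AntiBij (Sigma.Lex (fun _ _ => False) r) (Fin n)) =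
      Nat.card {χ : Fin n → J // ∀ j, Nat.card {t // χ t = j} = Nat.card (S j)} *
        ∏ j, Nat.card (AntiBij (r j) (Fin (Nat.card (S j)))) := by
  rw [← Nat.card_congr (Equiv.sigmaFiberEquiv
    fun f : AntiBij (Sigma.Lex (fun _ _ => False) r) (Fin n) => fun t => (f.1.symm t).1),
    Nat.card_sigma]
  have key (χ : Fin n → J) : Nat.card {f : AntiBij (Sigma.Lex (fun _ _ => False) r) (Fin n) //
      (fun t => (f.1.symm t).1) = χ} = if ∀ j, Nat.card {t // χ t = j} = Nat.card (S j) then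
        ∏ j, Nat.card (AntiBij (r j) (Fin (Nat.card (S j)))) else 0 := by
    rw [Nat.card_congr (fiberEquiv r χ), Nat.card_pi,
      Finset.prod_congr rfl fun j _ => card_eq_ite (r j), Finset.prod_ite_zero]
    simp only [Finset.mem_univ, true_imp_iff]
  rw [Finset.sum_congr rfl fun χ _ => key χ, ← Finset.sum_filter, Finset.sum_const,
    smul_eq_mul, Nat.card_eq_fintype_card, Fintype.card_subtype]

theorem card_false (S : Type*) [Finite S] :
    Nat.card (AntiBij (fun _ _ : S => False) (Fin (Nat.card S))) = (Nat.card S).factorial := by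
  classical
  have := Fintype.ofFinite S
  have e : AntiBij (fun _ _ : S => False) (Fin (Nat.card S)) ≃ (S ≃ Fin (Nat.card S)) :=
    Equiv.subtypeUnivEquiv fun _ _ _ h => h.elim
  rw [Nat.card_congr e, Nat.card_eq_fintype_card,
    Fintype.card_equiv (Finite.equivFin S), Nat.card_eq_fintype_card]

end AntiBij

/-- The proportion of bijections that are order-reversing. -/
noncomputable def antiRatio {S : Type*} (r : S → S → Prop) : ℚ :=
  Nat.card (AntiBij r (Fin (Nat.card S))) / (Nat.card S).factorial

theorem antiRatio_congr {S S' : Type*} {r : S → S → Prop} {r' : S' → S' → Prop} (e : S ≃ S')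
    (h : ∀ a b, r a b ↔ r' (e a) (e b)) : antiRatio r = antiRatio r' := by
  have hc := Nat.card_congr e
  rw [antiRatio, antiRatio, Nat.card_congr (AntiBij.congr e (Fin.castOrderIso hc) h), hc]

theorem antiRatio_sigma {J : Type*} [Fintype J] {S : J → Type*} [∀ j, Finite (S j)]
    (r : ∀ j, S j → S j → Prop) :
    antiRatio (Sigma.Lex (fun _ _ => False) r) = ∏ j, antiRatio (r j) := by
  have h := AntiBij.card_sigma_eq r (Nat.card (Σ j, S j))
  have h0 := AntiBij.card_sigma_eq (fun j (_ _ : S j) => False) (Nat.card (Σ j, S j))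
  have hF : Sigma.Lex (fun _ _ => False) (fun j (_ _ : S j) => False) = fun _ _ => False := by
    ext a b; simp [Sigma.lex_iff]
  rw [hF, AntiBij.card_false] at h0
  simp only [AntiBij.card_false] at h0
  simp only [antiRatio, Finset.prod_div_distrib]
  rw [h, h0]
  have h1 := Nat.factorial_ne_zero (Nat.card (Σ j, S j))
  rw [h0] at h1
  push_cast
  apply mul_div_mul_left
  exact_mod_cast left_ne_zero_of_mul h1

/-- The number of order-reversing bijections does not change when a maximum is removed. -/
theorem AntiBij.card_remove_top {S : Type*} [Finite S] (r : S → S → Prop) (x : S)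
    (hx : ∀ y, y ≠ x → r x y) (hxx : ∀ y, ¬ r y x) :
    Nat.card (AntiBij r (Fin (Nat.card S))) =
      Nat.card (AntiBij (fun a b : {y // y ≠ x} => r a b) (Fin (Nat.card {y // y ≠ x}))) := by
  classical
  have e : S ≃ Option {y // y ≠ x} := (Equiv.optionSubtypeNe x).symm
  have hc : Nat.card S = Nat.card {y // y ≠ x} + 1 := by
    rw [Nat.card_congr e, Finite.card_option]
  rw [hc]
  set n := Nat.card {y // y ≠ x}
  have top (f : AntiBij r (Fin (n + 1))) : f.1 x = Fin.last n := by
    by_contra h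
    have := f.2 x (f.1.symm (Fin.last n)) (hx _ fun h' => h (by rw [← h']; simp))
    rw [Equiv.apply_symm_apply] at this
    exact absurd (Fin.le_last (f.1 x)) (not_le.2 this)
  have ne (f : AntiBij r (Fin (n + 1))) (y : {y // y ≠ x}) : f.1 y ≠ Fin.last n := by
    rw [← top f]; simpa using y.2
  refine Nat.card_congr
    { toFun := fun f => ⟨Equiv.ofBijective (fun y => (f.1 y).castPred (ne f y)) ⟨?_, ?_⟩, ?_⟩
      invFun := fun g => ⟨Equiv.ofBijective
        (fun y => if h : y = x then Fin.last n else (g.1 ⟨y, h⟩).castSucc) ⟨?_, ?_⟩, ?_⟩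
      left_inv := fun f => ?_
      right_inv := fun g => ?_ }
  · intro a b h
    simpa [Subtype.ext_iff] using h
  · intro t
    refine ⟨⟨f.1.symm t.castSucc, fun h => ?_⟩, by simp⟩
    have := top f
    rw [← h] at this
    simp [Fin.castSucc_ne_last] at this
  · intro a b h
    exact Fin.lt_def.2 (f.2 _ _ h)
  · intro a b h
    dsimp only at h
    split_ifs at h with h1 h2 h2
    · rw [h1, h2]
    · exact absurd h.symm (Fin.castSucc_ne_last _)
    · exact absurd h (Fin.castSucc_ne_last _)
    · simpa [Subtype.ext_iff] using h
  · intro t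
    induction t using Fin.lastCases with
    | last => exact ⟨x, by simp⟩
    | cast t => exact ⟨g.1.symm t, by simp [(g.1.symm t).2]⟩
  · intro a b h
    have hb : b ≠ x := fun hb => hxx a (hb ▸ h)
    by_cases ha : a = x
    · simp [ha, hb, Fin.castSucc_lt_last]
    · simpa [ha, hb] using g.2 ⟨a, ha⟩ ⟨b, hb⟩ h
  · apply Subtype.ext
    ext y
    by_cases h : y = x
    · simp [h, top f]
    · simp only [Equiv.ofBijective_apply, dif_neg h]
      rfl
  · apply Subtype.ext
    ext y
    simp [y.2]

/-- The proportion of numberings of a set of words that strictly decrease along prefixes. -/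
noncomputable def wordRatio {α : Type*} (s : Set (List α)) : ℚ :=
  antiRatio (fun p q : s => p.1 <+: q.1 ∧ p.1 ≠ q.1)

/-- A nonempty word is determined by its first letter and its tail. -/
noncomputable def sigmaConsEquiv {α : Type*} {s : Set (List α)} (hs : [] ∉ s) :
    (Σ a, {q | a :: q ∈ s}) ≃ s :=
  Equiv.ofBijective (fun x => ⟨x.1 :: x.2.1, x.2.2⟩) (by
    constructor
    · rintro ⟨a, p, hp⟩ ⟨b, q, hq⟩ h
      simp only [Subtype.mk.injEq, List.cons.injEq] at h
      obtain ⟨rfl, rfl⟩ := h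
      rfl
    · rintro ⟨_ | ⟨a, q⟩, h⟩
      · exact absurd h hs
      · exact ⟨⟨a, q, h⟩, rfl⟩)

theorem finite_cons_mem {α : Type*} {s : Set (List α)} (hf : s.Finite) (a : α) :
    {q | a :: q ∈ s}.Finite :=
  hf.preimage fun _ _ _ _ h => (List.cons.inj h).2

theorem card_eq_sum_cons {α : Type*} [Fintype α] {s : Set (List α)} (hs : [] ∉ s)
    (hf : s.Finite) : Nat.card s = ∑ a, Nat.card {q | a :: q ∈ s} := by
  have (a : α) : Finite {q | a :: q ∈ s} := finite_cons_mem hf a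
  rw [← Nat.card_congr (sigmaConsEquiv hs), Nat.card_sigma]

theorem wordRatio_eq_prod_cons {α : Type*} [Fintype α] {s : Set (List α)} (hs : [] ∉ s)
    (hf : s.Finite) : wordRatio s = ∏ a, wordRatio {q | a :: q ∈ s} := by
  have (a : α) : Finite {q | a :: q ∈ s} := finite_cons_mem hf a
  simp only [wordRatio]
  rw [← antiRatio_sigma]
  refine (antiRatio_congr (sigmaConsEquiv hs) ?_).symm
  rintro ⟨a, p⟩ ⟨b, q⟩
  have hval (x : Σ a, {q | a :: q ∈ s}) : (sigmaConsEquiv hs x).1 = x.1 :: x.2.1 := rfl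
  simp only [hval, Sigma.lex_iff, false_or, List.cons_prefix_cons, ne_eq,
    List.cons.injEq]
  constructor
  · rintro ⟨rfl, h⟩
    simpa using h
  · rintro ⟨⟨rfl, h⟩, h'⟩
    exact ⟨rfl, h, by simpa using h'⟩

theorem card_remove_nil {α : Type*} {s : Set (List α)} (hs : [] ∈ s) (hf : s.Finite) :
    Nat.card s = Nat.card ↥(s \ {[]}) + 1 := by
  rw [Nat.card_coe_set_eq, Nat.card_coe_set_eq, Set.ncard_sdiff_singleton_add_one hs hf]

theorem card_antiBij_remove_nil {α : Type*} {s : Set (List α)} (hs : [] ∈ s) (hf : s.Finite) :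
    (Nat.card (AntiBij (fun p q : s => p.1 <+: q.1 ∧ p.1 ≠ q.1) (Fin (Nat.card s))) : ℚ) =
      wordRatio (s \ {[]}) * (Nat.card ↥(s \ {[]})).factorial := by
  have := hf.to_subtype
  rw [AntiBij.card_remove_top _ ⟨[], hs⟩]
  · let e : {y : s // y ≠ ⟨[], hs⟩} ≃ ↥(s \ {[]}) :=
      { toFun := fun y => ⟨y.1.1, y.1.2, fun h => y.2 (Subtype.ext h)⟩
        invFun := fun p => ⟨⟨p.1, p.2.1⟩, fun h => p.2.2 (congrArg Subtype.val h)⟩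
        left_inv := fun _ => rfl
        right_inv := fun _ => rfl }
    have h := Nat.card_congr (AntiBij.congr
      (r := fun p q : {y : s // y ≠ ⟨[], hs⟩} => p.1.1 <+: q.1.1 ∧ p.1.1 ≠ q.1.1)
      (r' := fun p q : ↥(s \ {[]}) => p.1 <+: q.1 ∧ p.1 ≠ q.1) e
      (Fin.castOrderIso (Nat.card_congr e)) fun _ _ => Iff.rfl)
    rw [h, wordRatio, antiRatio, div_mul_cancel₀ _ (by positivity)]
  · intro y hy
    exact ⟨List.nil_prefix, fun h => hy (Subtype.ext h.symm)⟩
  · intro y h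
    exact h.2 (List.prefix_nil.1 h.1)

theorem wordRatio_eq_div {α : Type*} {s : Set (List α)} (hs : [] ∈ s) (hf : s.Finite) :
    wordRatio s = wordRatio (s \ {[]}) / (Nat.card ↥(s \ {[]}) + 1) := by
  rw [wordRatio, antiRatio, card_antiBij_remove_nil hs hf, card_remove_nil hs hf,
    Nat.factorial_succ]
  have := Nat.factorial_ne_zero (Nat.card ↥(s \ {[]}))
  push_cast
  field_simp

theorem wordRatio_empty {α : Type*} : wordRatio (∅ : Set (List α)) = 1 := by
  have h : (fun p q : (∅ : Set (List α)) => p.1 <+: q.1 ∧ p.1 ≠ q.1) = fun _ _ => False := by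
    ext p
    exact p.2.elim
  rw [wordRatio, h, antiRatio, AntiBij.card_false, div_self (by positivity)]

namespace KTree

variable {d k : ℕ}

theorem induction_children {P : KTree d k → Prop}
    (h : ∀ c, (∀ π t, c π = some t → P t) → P (node c)) (M : KTree d k) : P M :=
  KTree.rec (motive_1 := P) (motive_2 := fun o => ∀ t, o = some t → P t)
    (fun c ih => h c ih) (fun _ h => by cases h)
    (fun _ ht _ h => Option.some.inj h ▸ ht) M

@[simp] theorem isVertex_nil (M : KTree d k) : M.isVertex [] := by
  cases M; simp [isVertex, subtreeAt]

theorem isVertex_cons (c : Dir d k → Option (KTree d k)) (π : Dir d k) (p : List (Dir d k)) :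
    (node c).isVertex (π :: p) ↔ ∃ t, c π = some t ∧ t.isVertex p := by
  rw [isVertex, subtreeAt]
  cases c π <;> simp [isVertex]

theorem finite_isVertex (M : KTree d k) : {p | M.isVertex p}.Finite := by
  induction M using induction_children with
  | h c ih =>
    have hfin : (insert [] (⋃ π, (π :: ·) '' {p | (node c).isVertex (π :: p)})).Finite := by
      refine Set.Finite.insert _ (Set.finite_iUnion fun π => Set.Finite.image _ ?_)
      simp only [isVertex_cons]
      cases hc : c π with
      | none => simp
      | some t => simpa using ih π t hc
    refine hfin.subset fun p hp => ?_
    cases p with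
    | nil => exact Set.mem_insert _ _
    | cons π p => exact Or.inr (Set.mem_iUnion.2 ⟨π, p, hp, rfl⟩)

/-- The vertices of `M` carrying an `i`-th entry, where `b` tells whether the root does. -/
def carriers (M : KTree d k) (i : Fin d) (b : Prop) : Set (List (Dir d k)) :=
  {p | M.isVertex p ∧ p.getLast?.elim b fun π => i ∈ π.1}

theorem finite_carriers (M : KTree d k) (i : Fin d) (b : Prop) : (M.carriers i b).Finite :=
  M.finite_isVertex.subset fun _ h => h.1

theorem carriers_true (M : KTree d k) (i : Fin d) :
    M.carriers i True = {p | M.isVertex p ∧ i ∈ dirOf p} := by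
  ext p
  simp only [carriers, dirOf, Set.mem_ofPred_eq]
  cases p.getLast? <;> simp

theorem nil_mem_carriers (M : KTree d k) (i : Fin d) (b : Prop) : [] ∈ M.carriers i b ↔ b := by
  simp [carriers]

theorem carriers_true_diff (M : KTree d k) (i : Fin d) :
    M.carriers i True \ {[]} = M.carriers i False := by
  ext p
  cases p with
  | nil => simp [carriers]
  | cons a p => simp [carriers, List.getLast?_cons]

theorem cons_mem_carriers (c : Dir d k → Option (KTree d k)) (i : Fin d) (b : Prop)
    (π : Dir d k) : {p | π :: p ∈ (node c).carriers i b} =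
      (c π).elim ∅ fun t => t.carriers i (i ∈ π.1) := by
  ext p
  simp only [carriers, Set.mem_ofPred_eq, isVertex_cons, List.getLast?_cons]
  cases c π <;> cases h : p.getLast? <;> simp [h]

/-- The number of non-root vertices carrying an `i`-th entry, as an exponent vector. -/
noncomputable def deg (M : KTree d k) : Fin d →₀ ℕ :=
  Finsupp.equivFunOnFinite.symm fun i => Nat.card (M.carriers i False)

/-- The contribution of the shape `M` to the coefficient of the generating series. -/
noncomputable def weight (M : KTree d k) : ℚ := ∏ i, wordRatio (M.carriers i False)

/-- The exponent vector contributed by a possible child in direction `π`. -/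
noncomputable def childDeg (π : Dir d k) (o : Option (KTree d k)) : Fin d →₀ ℕ :=
  o.elim 0 fun t => t.deg + ∑ i ∈ π.1, Finsupp.single i 1

/-- The weight contributed by a possible child in direction `π`. -/
noncomputable def childWeight (π : Dir d k) (o : Option (KTree d k)) : ℚ :=
  o.elim 1 fun t => (∏ i ∈ π.1, ((t.deg i : ℚ) + 1))⁻¹ * t.weight

theorem card_carriers (M : KTree d k) (i : Fin d) (b : Prop) [Decidable b] :
    Nat.card (M.carriers i b) = M.deg i + if b then 1 else 0 := by
  by_cases h : b
  · simp only [h, if_true]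
    rw [card_remove_nil (by simp [nil_mem_carriers]) (M.finite_carriers i True),
      carriers_true_diff]
    simp [deg]
  · simp [deg, h]

theorem wordRatio_carriers (M : KTree d k) (i : Fin d) (b : Prop) [Decidable b] :
    wordRatio (M.carriers i b) =
      (if b then ((M.deg i : ℚ) + 1)⁻¹ else 1) * wordRatio (M.carriers i False) := by
  by_cases h : b
  · simp only [h, if_true]
    rw [wordRatio_eq_div (by simp [nil_mem_carriers]) (M.finite_carriers i True),
      carriers_true_diff, card_carriers]
    simp [div_eq_inv_mul]
  · simp [h]

theorem deg_node (c : Dir d k → Option (KTree d k)) :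
    (node c).deg = ∑ π, childDeg π (c π) := by
  ext i
  rw [Finsupp.finsetSum_apply]
  have h : (node c).deg i = Nat.card ((node c).carriers i False) := by simp [deg]
  rw [h, card_eq_sum_cons (by simp [nil_mem_carriers]) (finite_carriers _ i _)]
  refine Finset.sum_congr rfl fun π _ => ?_
  rw [cons_mem_carriers]
  cases c π with
  | none => simp [childDeg]
  | some t =>
    simp only [Option.elim_some, card_carriers t i (i ∈ π.1)]
    simp [childDeg, Finsupp.single_apply]

theorem weight_node (c : Dir d k → Option (KTree d k)) :
    (node c).weight = ∏ π, childWeight π (c π) := by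
  have h (i : Fin d) : wordRatio ((node c).carriers i False) = ∏ π,
      wordRatio ((c π).elim ∅ fun t => t.carriers i (i ∈ π.1)) := by
    rw [wordRatio_eq_prod_cons (by simp [nil_mem_carriers]) (finite_carriers _ i _)]
    simp only [cons_mem_carriers]
  rw [weight, Finset.prod_congr rfl fun i _ => h i, Finset.prod_comm]
  refine Finset.prod_congr rfl fun π _ => ?_
  cases c π with
  | none => simp [childWeight, wordRatio_empty]
  | some t =>
    simp only [Option.elim_some, wordRatio_carriers t _ (_ ∈ _), Finset.prod_mul_distrib]
    simp [childWeight, weight, Finset.prod_ite_mem]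

theorem finite_setOf_deg_eq (hk : 1 ≤ k) (e : Fin d →₀ ℕ) :
    {M : KTree d k | M.deg = e}.Finite := by
  have key (n : ℕ) : {M : KTree d k | M.deg.degree < n}.Finite := by
    induction n with
    | zero => simp
    | succ n ih =>
      have hfin : (node '' Set.pi Set.univ fun _ : Dir d k =>
          insert none (some '' {M : KTree d k | M.deg.degree < n})).Finite :=
        (Set.Finite.pi' fun _ => (ih.image some).insert none).image _ |>.subset (by
          refine Set.image_mono fun c hc π => hc π trivial)
      refine hfin.subset ?_
      rintro ⟨c⟩ hM
      refine ⟨c, fun π _ => ?_, rfl⟩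
      cases hc : c π with
      | none => exact Set.mem_insert _ _
      | some t =>
        refine Or.inr ⟨t, ?_, rfl⟩
        have h1 : (childDeg π (c π)).degree ≤ (node c).deg.degree := by
          rw [deg_node, map_sum]
          exact Finset.single_le_sum (f := fun π => (childDeg π (c π)).degree)
            (fun _ _ => Nat.zero_le _) (Finset.mem_univ π)
        have h2 : (childDeg π (c π)).degree = t.deg.degree + k := by
          simp [hc, childDeg, map_sum, π.2]
        have h3 : (node c).deg.degree < n + 1 := hM
        show t.deg.degree < n
        omega
  exact (key (e.degree + 1)).subset fun M hM => by
    have : M.deg = e := hM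
    simp [this]

end KTree

namespace KNAT

variable {d k : ℕ} {M : KTree d k}

@[ext] theorem ext {N N' : KNAT d k M} (h : N.lbl = N'.lbl) : N = N' := by
  cases N; cases N'; cases h; rfl

theorem lbl_bijOn (N : KNAT d k M) (i : Fin d) :
    Set.BijOn (fun p => N.lbl p i) (M.carriers i True)
      (Set.Icc 1 (Nat.card (M.carriers i True))) := by
  rw [KTree.carriers_true, Nat.card_coe_set_eq, ← N.interval i]
  exact (N.inj i).bijOn_image

theorem lbl_nil (N : KNAT d k M) (i : Fin d) : N.lbl [] i = M.deg i + 1 := by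
  have hc : Nat.card (M.carriers i True) = M.deg i + 1 := by
    simp only [M.card_carriers i True, if_true]
  have hb := N.lbl_bijOn i
  rw [hc] at hb
  have h0 : [] ∈ M.carriers i True := by simp [KTree.nil_mem_carriers]
  obtain ⟨p, hp, h⟩ := hb.surjOn (show M.deg i + 1 ∈ Set.Icc 1 (M.deg i + 1) by simp)
  have hle := (hb.mapsTo h0).2
  by_cases hne : p = []
  · rw [← hne]; exact h
  · rw [KTree.carriers_true] at hp h0
    have := N.anc [] p h0.1 hp.1 List.nil_prefix (Ne.symm hne) i h0.2 hp.2
    dsimp only at h hle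
    omega

/-- A `(d,k)`-NAT of shape `M` amounts to independent labellings in all coordinates. -/
noncomputable def equivPi (M : KTree d k) : KNAT d k M ≃ ∀ i, AntiBij
    (fun p q : M.carriers i True => p.1 <+: q.1 ∧ p.1 ≠ q.1)
    (Set.Icc 1 (Nat.card (M.carriers i True))) := by
  classical
  exact
  { toFun := fun N i => ⟨(N.lbl_bijOn i).equiv, fun p q h => by
      have hp := (M.carriers_true i).subset p.2
      have hq := (M.carriers_true i).subset q.2
      exact N.anc p q hp.1 hq.1 h.1 h.2 i hp.2 hq.2⟩
    invFun := fun g =>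
      { lbl := fun p i => if h : p ∈ M.carriers i True then (g i).1 ⟨p, h⟩ else 0
        supp := fun p i h => by
          rw [dif_neg]
          rwa [KTree.carriers_true]
        anc := fun p q hp hq hpq hne i hpi hqi => by
          have hp' : p ∈ M.carriers i True := by rw [KTree.carriers_true]; exact ⟨hp, hpi⟩
          have hq' : q ∈ M.carriers i True := by rw [KTree.carriers_true]; exact ⟨hq, hqi⟩
          rw [dif_pos hp', dif_pos hq']
          exact (g i).2 ⟨p, hp'⟩ ⟨q, hq'⟩ ⟨hpq, hne⟩
        inj := fun i => by
          rw [← KTree.carriers_true]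
          intro p hp q hq h
          simp only [hp, hq, dif_pos] at h
          exact congrArg Subtype.val ((g i).1.injective (Subtype.ext h))
        interval := fun i => by
          rw [← KTree.carriers_true, ← Nat.card_coe_set_eq]
          ext t
          constructor
          · rintro ⟨p, hp, rfl⟩
            simp only [hp, dif_pos]
            exact ((g i).1 ⟨p, hp⟩).2
          · intro ht
            refine ⟨((g i).1.symm ⟨t, ht⟩).1, ((g i).1.symm ⟨t, ht⟩).2, ?_⟩
            simp only [Subtype.coe_prop, dif_pos, Subtype.coe_eta]
            exact congrArg Subtype.val ((g i).1.apply_symm_apply ⟨t, ht⟩) }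
    left_inv := fun N => by
      ext p i
      dsimp only
      split_ifs with h
      · rfl
      · rw [KTree.carriers_true] at h
        exact (N.supp p i h).symm
    right_inv := fun g => by
      funext i
      apply Subtype.ext
      ext p
      exact dif_pos p.2 }

instance (M : KTree d k) : Finite (KNAT d k M) := Finite.of_equiv _ (equivPi M).symm

theorem card_eq (M : KTree d k) :
    (Nat.card (KNAT d k M) : ℚ) = M.weight * ∏ i, ((M.deg i).factorial : ℚ) := by
  rw [Nat.card_congr (equivPi M), Nat.card_pi, KTree.weight, ← Finset.prod_mul_distrib,
    Nat.cast_prod]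
  refine Finset.prod_congr rfl fun i _ => ?_
  have := (M.finite_carriers i True).to_subtype
  rw [AntiBij.card_eq_ite, if_pos (by simp),
    card_antiBij_remove_nil (by simp [KTree.nil_mem_carriers]) (M.finite_carriers i True),
    M.carriers_true_diff]
  simp [KTree.deg]

end KNAT

section GeneratingSeries

open MvPowerSeries

variable {d k : ℕ}

theorem coeff_knatGF (e : Fin d →₀ ℕ) (F : Finset (KTree d k)) (hF : ∀ M, M ∈ F ↔ M.deg = e) :
    coeff e (knatGF d k) = ∑ M ∈ F, M.weight := by
  have hcoe : coeff e (knatGF d k) = knatGF d k e := rfl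
  let E : {N : Σ M : KTree d k, KNAT d k M // ∀ i, N.2.lbl [] i = e i + 1} ≃
      Σ M : F, KNAT d k M.1 :=
    { toFun := fun N => ⟨⟨N.1.1, (hF _).2 (by
        ext i
        have := N.2 i
        rw [N.1.2.lbl_nil] at this
        omega)⟩, N.1.2⟩
      invFun := fun N => ⟨⟨N.1.1, N.2⟩, fun i => by
        rw [N.2.lbl_nil, (hF _).1 N.1.2]⟩
      left_inv := fun _ => rfl
      right_inv := fun _ => rfl }
  rw [hcoe, knatGF, Nat.card_congr E, Nat.card_sigma, Nat.cast_sum, Finset.sum_div,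
    ← Finset.sum_coe_sort F]
  refine Finset.sum_congr rfl fun M _ => ?_
  rw [KNAT.card_eq, (hF _).1 M.2, mul_div_cancel_right₀]
  positivity

theorem finite_setOf_childDeg_eq (hk : 1 ≤ k) (π : Dir d k) (e : Fin d →₀ ℕ) :
    {o : Option (KTree d k) | KTree.childDeg π o = e}.Finite := by
  refine (((KTree.finite_setOf_deg_eq hk
    (e - ∑ i ∈ π.1, Finsupp.single i 1)).image some).insert none).subset ?_
  rintro (_ | t) h
  · exact Set.mem_insert _ _
  · refine Or.inr ⟨t, ?_, rfl⟩
    have h : t.deg + ∑ i ∈ π.1, Finsupp.single i 1 = e := h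
    exact (tsub_eq_of_eq_add h.symm).symm

theorem coeff_one_add_intS (π : Dir d k) (e : Fin d →₀ ℕ)
    (F : Finset (Option (KTree d k))) (hF : ∀ o, o ∈ F ↔ KTree.childDeg π o = e) :
    coeff e (1 + intS π.1 (knatGF d k)) = ∑ o ∈ F, KTree.childWeight π o := by
  classical
  set u : Fin d →₀ ℕ := ∑ i ∈ π.1, Finsupp.single i 1 with hu
  have hui (i : Fin d) : u i = if i ∈ π.1 then 1 else 0 := by
    simp [hu, Finsupp.single_apply]
  have hint : coeff e (intS π.1 (knatGF d k)) = ∑ t ∈ F.eraseNone,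
      KTree.childWeight π (some t) := by
    have hcoe : coeff e (intS π.1 (knatGF d k)) = intS π.1 (knatGF d k) e := rfl
    rw [hcoe, intS]
    split_ifs with h
    · have hle : u ≤ e := fun i => by
        rw [hui]
        split_ifs with hi
        · exact Nat.one_le_iff_ne_zero.2 (h i hi)
        · exact Nat.zero_le _
      have hF' (t : KTree d k) : t ∈ F.eraseNone ↔ t.deg = e - u := by
        rw [Finset.mem_eraseNone, hF]
        exact (eq_tsub_iff_add_eq_of_le hle).symm
      have := coeff_knatGF (e - u) F.eraseNone hF'
      change _ * coeff (e - u) (knatGF d k) = _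
      rw [this, Finset.mul_sum]
      refine Finset.sum_congr rfl fun t ht => ?_
      simp only [KTree.childWeight, Option.elim_some]
      congr 2
      refine Finset.prod_congr rfl fun i hi => ?_
      have hi' : t.deg i = e i - u i := by rw [(hF' t).1 ht]; rfl
      rw [hui, if_pos hi] at hi'
      have := h i hi
      have : e i = t.deg i + 1 := by omega
      rw [this]
      push_cast
      rfl
    · rw [Finset.sum_eq_zero]
      intro t ht
      refine absurd (fun i hi => ?_) h
      rw [Finset.mem_eraseNone, hF] at ht
      have ht : t.deg + u = e := ht
      rw [← ht, Finsupp.add_apply, hui, if_pos hi]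
      omega
  have hsum : ∑ t ∈ F.eraseNone, KTree.childWeight π (some t) =
      ∑ o ∈ F.erase none, KTree.childWeight π o := by
    rw [← Finset.map_some_eraseNone, Finset.sum_map]
    rfl
  rw [map_add, hint, coeff_one, hsum]
  by_cases h : e = 0
  · have hn : none ∈ F := (hF none).2 h.symm
    rw [if_pos h, ← Finset.add_sum_erase F _ hn]
    rfl
  · have hn : none ∉ F := fun hn => h ((hF none).1 hn).symm
    rw [if_neg h, zero_add, Finset.erase_eq_of_notMem hn]

/-- Coefficient extraction from a product of weighted counting series. -/
theorem coeff_prod_eq_sum {J σ R : Type*} [Fintype J] [CommSemiring R]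
    {X : Type*} (f : J → MvPowerSeries σ R) (δ : J → X → σ →₀ ℕ) (w : J → X → R)
    (F : J → (σ →₀ ℕ) → Finset X) (hF : ∀ j e x, x ∈ F j e ↔ δ j x = e)
    (hf : ∀ j e, coeff e (f j) = ∑ x ∈ F j e, w j x) (e : σ →₀ ℕ)
    (B : Finset (J → X)) (hB : ∀ c, c ∈ B ↔ ∑ j, δ j (c j) = e) :
    coeff e (∏ j, f j) = ∑ c ∈ B, ∏ j, w j (c j) := by
  classical
  rw [coeff_prod, ← Finset.sum_fiberwise_of_maps_to
    (s := B) (g := fun c => Finsupp.equivFunOnFinite.symm fun j => δ j (c j))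
    (t := Finset.finsuppAntidiag Finset.univ e)]
  · refine Finset.sum_congr rfl fun l hl => ?_
    simp_rw [hf]
    rw [Finset.prod_univ_sum]
    refine Finset.sum_congr ?_ fun _ _ => rfl
    ext c
    rw [Finset.mem_finsuppAntidiag] at hl
    simp only [Fintype.mem_piFinset, hF, Finset.mem_filter, hB]
    constructor
    · intro h
      refine ⟨?_, Finsupp.ext h⟩
      simpa [h] using hl.1
    · rintro ⟨_, rfl⟩ j
      rfl
  · intro c hc
    rw [hB] at hc
    simpa [Finset.mem_finsuppAntidiag] using hc

end GeneratingSeries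

/-- `G = ∏_π (1 + ∫_π G)`, the product running over all
`(d,k)`-directions `π`. -/
theorem knatGF_eq (d k : ℕ) (hk : 1 ≤ k) (hkd : k ≤ d) :
    knatGF d k = ∏ π : Dir d k, (1 + intS π.1 (knatGF d k)) := by
  ext e
  set F := (KTree.finite_setOf_deg_eq (d := d) hk e).toFinset with hFdef
  have hF (M : KTree d k) : M ∈ F ↔ M.deg = e := by simp [hFdef]
  let unnode : KTree d k ≃ (Dir d k → Option (KTree d k)) :=
    { toFun := fun | .node c => c
      invFun := .node
      left_inv := fun ⟨_⟩ => rfl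
      right_inv := fun _ => rfl }
  rw [coeff_knatGF e F hF, coeff_prod_eq_sum _ KTree.childDeg KTree.childWeight
    (fun π e => (finite_setOf_childDeg_eq hk π e).toFinset) (fun π e o => by simp)
    (fun π e => coeff_one_add_intS π e _ fun o => by simp) e (F.map unnode.toEmbedding)]
  · rw [Finset.sum_map]
    refine Finset.sum_congr rfl fun M _ => ?_
    cases M
    exact KTree.weight_node _
  · intro c
    rw [Finset.mem_map_equiv, hF]
    exact Eq.congr_left (KTree.deg_node c)
end
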